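/- For 0 ≤ i ≤ n, the dual Bernstein polynomials satisfy the second-order non-homogeneous recurrence i(i+1)(n-i+α+1)(x-1) D^n_{i-1}(x;α,β) - (n-i)(n-i+1)(i+β+1) x D^n_{i+1}(x;α,β) + (i+1)(n-i+1)[(i+β+1)(1-x) + (n-i+α+1)x] D^n_i(x;α,β) = A^{(α,β)}_{ni} [(i+1)(n+β+1)(1-x) R^{(α+1,β)}_n(x) + (n-i+1)(n+α+1) x R^{(α,β+1)}_n(x)], with D^n_{-1} := D^n_{n+1} := 0. -/

import Mathlib

open scoped BigOperators
open MeasureTheory Polynomial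

/-- Pochhammer symbol `(c)_l = c (c+1) ⋯ (c+l-1)`. -/
noncomputable def poch (c : ℝ) (l : ℕ) : ℝ := ∏ j ∈ Finset.range l, (c + j)

/-- Shifted Jacobi polynomial `R_k^{(α,β)}(x)`. -/
noncomputable def jacobiR (α β : ℝ) (k : ℕ) (x : ℝ) : ℝ :=
  poch (α + 1) k / (Nat.factorial k) *
    ∑ l ∈ Finset.range (k + 1),
      poch (-(k : ℝ)) l * poch ((k : ℝ) + α + β + 1) l /
        (poch (α + 1) l * (Nat.factorial l)) * (1 - x) ^ l

/-- Hahn polynomial `Q_k(x; α, β; N)`. -/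
noncomputable def hahnQ (α β : ℝ) (N k : ℕ) (x : ℝ) : ℝ :=
  ∑ l ∈ Finset.range (k + 1),
    poch (-(k : ℝ)) l * poch ((k : ℝ) + α + β + 1) l * poch (-x) l /
      (poch (α + 1) l * poch (-(N : ℝ)) l * (Nat.factorial l))

/-- Bernstein basis polynomial `B^n_i(x)` as a real function. -/
noncomputable def bern (n i : ℕ) (x : ℝ) : ℝ :=
  (n.choose i : ℝ) * x ^ i * (1 - x) ^ (n - i)

/-- `D 0, …, D n` are the dual Bernstein polynomials of degree `n` with
parameters `α, β`: they have degree at most `n` and are biorthogonal to the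
Bernstein basis w.r.t. the weight `(1-x)^α x^β` on `[0,1]`. -/
def IsDualBernstein (n : ℕ) (α β : ℝ) (D : ℕ → Polynomial ℝ) : Prop :=
  (∀ j, j ≤ n → (D j).natDegree ≤ n) ∧
  ∀ i, i ≤ n → ∀ j, j ≤ n →
    (∫ x in (0:ℝ)..1, (1 - x) ^ α * x ^ β * bern n i x * (D j).eval x)
      = if i = j then (1:ℝ) else 0


lemma poch_zero' (c : ℝ) : poch c 0 = 1 := by simp [poch]

lemma poch_succ' (c : ℝ) (l : ℕ) : poch c (l + 1) = poch c l * (c + l) := by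
  simp [poch, Finset.prod_range_succ]

lemma poch_succ_left (c : ℝ) (l : ℕ) : poch c (l + 1) = c * poch (c + 1) l := by
  simp only [poch, Finset.prod_range_succ']
  rw [mul_comm]
  congr 1
  · simp
  · apply Finset.prod_congr rfl
    intro j _
    push_cast; ring

lemma poch_pos' (c : ℝ) (hc : 0 < c) (l : ℕ) : 0 < poch c l :=
  Finset.prod_pos fun j _ => by positivity

lemma Gamma_add_nat' (c : ℝ) (hc : 0 < c) (l : ℕ) :
    Real.Gamma (c + l) = poch c l * Real.Gamma c := by
  induction l with
  | zero => simp [poch]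
  | succ l ih =>
    have h : c + ((l + 1 : ℕ) : ℝ) = (c + l) + 1 := by push_cast; ring
    rw [h, Real.Gamma_add_one (by positivity), ih, poch_succ']
    ring

lemma poch_one' (n : ℕ) : poch 1 n = n.factorial := by
  induction n with
  | zero => simp [poch]
  | succ n ih => rw [poch_succ', ih, Nat.factorial_succ]; push_cast; ring

lemma poch_neg_nat (n l : ℕ) : poch (-(n : ℝ)) l = (-1) ^ l * (n.choose l) * l.factorial := by
  induction l with
  | zero => simp [poch]
  | succ l ih =>
    rw [poch_succ', ih, Nat.factorial_succ, pow_succ]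
    rcases le_or_gt l n with h | h
    · have h2 : ((n.choose (l + 1) : ℕ) : ℝ) * (l + 1) = n.choose l * ((n : ℝ) - l) := by
        have := Nat.choose_succ_right_eq n l
        rw [← Nat.cast_sub h]
        exact_mod_cast this
      push_cast
      linear_combination (-(-1 : ℝ) ^ l * (-1) * l.factorial) * h2
    · rw [Nat.choose_eq_zero_of_lt h, Nat.choose_eq_zero_of_lt (by omega)]
      simp

/-- Chu-Vandermonde identity. -/
lemma chu (n : ℕ) : ∀ (c d : ℝ), 0 < d →
    ∑ l ∈ Finset.range (n + 1), (-1 : ℝ) ^ l * (n.choose l) * (poch c l / poch d l)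
      = poch (d - c) n / poch d n := by
  induction n with
  | zero => intro c d _; simp [poch]
  | succ n ih =>
    intro c d hd
    have h1 := ih c d hd
    have h2 := ih (c + 1) (d + 1) (by linarith)
    have hsplit : ∑ l ∈ Finset.range (n + 1 + 1),
        (-1 : ℝ) ^ l * ((n + 1).choose l) * (poch c l / poch d l)
        = ∑ l ∈ Finset.range (n + 1), (-1 : ℝ) ^ l * (n.choose l) * (poch c l / poch d l)
        - c / d * ∑ l ∈ Finset.range (n + 1),
          (-1 : ℝ) ^ l * (n.choose l) * (poch (c + 1) l / poch (d + 1) l) := by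
      rw [Finset.sum_range_succ']
      have e : ∀ l ∈ Finset.range (n + 1),
          (-1 : ℝ) ^ (l + 1) * ((n + 1).choose (l + 1)) * (poch c (l + 1) / poch d (l + 1))
          = (-1 : ℝ) ^ (l + 1) * (n.choose (l + 1)) * (poch c (l + 1) / poch d (l + 1))
            - c / d * ((-1 : ℝ) ^ l * (n.choose l) * (poch (c + 1) l / poch (d + 1) l)) := by
        intro l _
        rw [Nat.choose_succ_succ, poch_succ_left c, poch_succ_left d, pow_succ, mul_div_mul_comm]
        push_cast; ring
      rw [Finset.sum_congr rfl e, Finset.sum_sub_distrib, ← Finset.mul_sum]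
      have h3 : ∑ l ∈ Finset.range (n + 1 + 1),
          (-1 : ℝ) ^ l * (n.choose l) * (poch c l / poch d l)
          = ∑ l ∈ Finset.range (n + 1), (-1 : ℝ) ^ l * (n.choose l) * (poch c l / poch d l) := by
        rw [Finset.sum_range_succ]; simp
      rw [← h3, Finset.sum_range_succ' _ (n + 1)]
      simp; ring
    rw [hsplit, h1, h2, show d + 1 - (c + 1) = d - c by ring, poch_succ']
    have p1 := poch_pos' d hd n
    have p2 := poch_pos' (d + 1) (by linarith) n
    have p3 : poch d n * (d + n) = d * poch (d + 1) n := by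
      rw [← poch_succ', poch_succ_left]
    have p4 : (0 : ℝ) < d + n := by positivity
    rw [poch_succ' d]
    have p5 : poch (d + 1) n = poch d n * (d + n) / d := by
      rw [p3]; field_simp
    rw [p5]
    field_simp
    ring

lemma findiff (n : ℕ) (P : ℝ[X]) (hP : P.natDegree < n) :
    ∑ l ∈ Finset.range (n + 1), (-1 : ℝ) ^ l * (n.choose l) * P.eval (l : ℝ) = 0 := by
  have h := congrFun (Polynomial.fwdDiff_iter_eq_zero_of_degree_lt hP) (0 : ℝ)
  rw [fwdDiff_iter_eq_sum_shift] at h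
  have e : ∀ l ∈ Finset.range (n + 1), (-1 : ℝ) ^ l * (n.choose l) * P.eval (l : ℝ)
      = (-1 : ℝ) ^ n * (((-1 : ℤ) ^ (n - l) * n.choose l) • P.eval (0 + l • (1 : ℝ))) := by
    intro l hl
    have hl' : l ≤ n := Nat.lt_succ_iff.mp (Finset.mem_range.mp hl)
    have : (-1 : ℝ) ^ n * (-1) ^ (n - l) = (-1) ^ l := by
      obtain ⟨m, rfl⟩ := Nat.exists_eq_add_of_le hl'
      rw [Nat.add_sub_cancel_left, pow_add, mul_assoc, ← mul_pow]; simp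
    simp only [zsmul_eq_mul]
    push_cast
    rw [← this]
    simp
    ring
  rw [Finset.sum_congr rfl e, ← Finset.mul_sum, h]
  simp

/-- Pochhammer as a polynomial in the argument. -/
noncomputable def pochP (q : ℝ[X]) (k : ℕ) : ℝ[X] := ∏ j ∈ Finset.range k, (q + C (j : ℝ))

lemma pochP_eval (q : ℝ[X]) (k : ℕ) (x : ℝ) : (pochP q k).eval x = poch (q.eval x) k := by
  simp [pochP, poch, Polynomial.eval_prod]

lemma pochP_deg (q : ℝ[X]) (hq : q.natDegree ≤ 1) (k : ℕ) : (pochP q k).natDegree ≤ k := by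
  refine (Polynomial.natDegree_prod_le _ _).trans ?_
  refine (Finset.sum_le_sum (g := fun _ => 1) ?_).trans (by simp)
  intro j _
  refine (Polynomial.natDegree_add_le _ _).trans ?_
  simp [hq]

lemma wt_integrable (a b : ℝ) (ha : -1 < a) (hb : -1 < b) :
    IntervalIntegrable (fun x : ℝ => (1 - x) ^ a * x ^ b) volume 0 1 := by
  have h := Complex.betaIntegral_convergent (u := ((b + 1 : ℝ) : ℂ)) (v := ((a + 1 : ℝ) : ℂ))
    (by simp; linarith) (by simp; linarith)
  rw [intervalIntegrable_iff_integrableOn_Ioo_of_le zero_le_one] at h ⊢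
  have h2 := h.re
  refine (IntegrableOn.congr_fun h2 ?_ measurableSet_Ioo)
  intro x hx
  have h0 : (0 : ℝ) ≤ x := hx.1.le
  have h1 : (0 : ℝ) ≤ 1 - x := by linarith [hx.2]
  simp only
  have e1 : ((b + 1 : ℝ) : ℂ) - 1 = ((b : ℝ) : ℂ) := by push_cast; ring
  have e2 : ((a + 1 : ℝ) : ℂ) - 1 = ((a : ℝ) : ℂ) := by push_cast; ring
  rw [e1, e2, ← Complex.ofReal_cpow h0, ← Complex.ofReal_one, ← Complex.ofReal_sub,
    ← Complex.ofReal_cpow h1, ← Complex.ofReal_mul]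
  simp [mul_comm]

lemma wt_integral (a b : ℝ) (ha : -1 < a) (hb : -1 < b) :
    ∫ x in (0:ℝ)..1, (1 - x) ^ a * x ^ b
      = Real.Gamma (a + 1) * Real.Gamma (b + 1) / Real.Gamma (a + b + 2) := by
  have h := ProbabilityTheory.beta_eq_betaIntegralReal (b + 1) (a + 1) (by linarith) (by linarith)
  have e : Complex.betaIntegral ((b + 1 : ℝ) : ℂ) ((a + 1 : ℝ) : ℂ)
      = ((∫ x in (0:ℝ)..1, (1 - x) ^ a * x ^ b : ℝ) : ℂ) := by
    rw [Complex.betaIntegral, ← intervalIntegral.integral_ofReal]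
    apply intervalIntegral.integral_congr
    intro x hx
    rw [Set.uIcc_of_le zero_le_one] at hx
    have h0 : (0 : ℝ) ≤ x := hx.1
    have h1 : (0 : ℝ) ≤ 1 - x := by linarith [hx.2]
    simp only
    have e1 : ((b + 1 : ℝ) : ℂ) - 1 = ((b : ℝ) : ℂ) := by push_cast; ring
    have e2 : ((a + 1 : ℝ) : ℂ) - 1 = ((a : ℝ) : ℂ) := by push_cast; ring
    rw [e1, e2, ← Complex.ofReal_cpow h0, ← Complex.ofReal_one, ← Complex.ofReal_sub,
      ← Complex.ofReal_cpow h1, ← Complex.ofReal_mul, mul_comm]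
  rw [e, Complex.ofReal_re] at h
  rw [← h, ProbabilityTheory.beta, show b + 1 + (a + 1) = a + b + 2 by ring]
  ring

lemma wtp_integrable (a b : ℝ) (ha : -1 < a) (hb : -1 < b) (p : ℝ[X]) :
    IntervalIntegrable (fun x : ℝ => (1 - x) ^ a * x ^ b * p.eval x) volume 0 1 :=
  (wt_integrable a b ha hb).mul_continuousOn p.continuous.continuousOn

/-- The weighted integral functional. -/
noncomputable def LL (a b : ℝ) (ha : -1 < a) (hb : -1 < b) : ℝ[X] →ₗ[ℝ] ℝ where
  toFun p := ∫ x in (0:ℝ)..1, (1 - x) ^ a * x ^ b * p.eval x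
  map_add' p q := by
    rw [← intervalIntegral.integral_add (wtp_integrable a b ha hb p) (wtp_integrable a b ha hb q)]
    simp [mul_add]
  map_smul' c p := by
    simp only [RingHom.id_apply, smul_eq_mul]
    rw [← intervalIntegral.integral_const_mul]
    simp only [Polynomial.eval_smul, smul_eq_mul]
    congr 1; ext x; ring

lemma LL_apply (a b : ℝ) (ha : -1 < a) (hb : -1 < b) (p : ℝ[X]) :
    LL a b ha hb p = ∫ x in (0:ℝ)..1, (1 - x) ^ a * x ^ b * p.eval x := rfl

lemma LL_shift (a b : ℝ) (ha : -1 < a) (hb : -1 < b) (j k : ℕ) (p : ℝ[X])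
    (ha' : -1 < a + k) (hb' : -1 < b + j) :
    LL a b ha hb (X ^ j * (1 - X) ^ k * p) = LL (a + k) (b + j) ha' hb' p := by
  rw [LL_apply, LL_apply]
  apply intervalIntegral.integral_congr_ae
  have h1 : ∀ᵐ x : ℝ, x ≠ 1 := by simp [ae_iff, measure_singleton]
  filter_upwards [h1] with x hx1 hx
  rw [Set.uIoc_of_le zero_le_one] at hx
  have h0 : (0 : ℝ) < x := hx.1
  have h2 : (0 : ℝ) < 1 - x := by
    have := lt_of_le_of_ne hx.2 hx1
    linarith
  rw [Real.rpow_add_natCast h0.ne', Real.rpow_add_natCast h2.ne']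
  simp
  ring

lemma LL_mono (a b : ℝ) (ha : -1 < a) (hb : -1 < b) (j k : ℕ) :
    LL a b ha hb (X ^ j * (1 - X) ^ k)
      = Real.Gamma (a + k + 1) * Real.Gamma (b + j + 1) / Real.Gamma (a + b + j + k + 2) := by
  have ha' : -1 < a + k := by have : (0:ℝ) ≤ k := by positivity
                              linarith
  have hb' : -1 < b + j := by have : (0:ℝ) ≤ j := by positivity
                              linarith
  have := LL_shift a b ha hb j k 1 ha' hb'
  rw [mul_one] at this
  rw [this, LL_apply]
  simp only [Polynomial.eval_one, mul_one]
  rw [wt_integral _ _ ha' hb', show a + k + (b + j) + 2 = a + b + j + k + 2 by ring]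

lemma LL_sq_zero (a b : ℝ) (ha : -1 < a) (hb : -1 < b) (q : ℝ[X])
    (h : LL a b ha hb (q * q) = 0) : q = 0 := by
  by_contra hq
  have hpos : 0 < LL a b ha hb (q * q) := by
    rw [LL_apply, intervalIntegral.integral_pos_iff_support_of_nonneg_ae' _
      (wtp_integrable a b ha hb _)]
    · refine ⟨zero_lt_one, ?_⟩
      have hsub : Set.Ioo (0:ℝ) 1 \ (q.roots.toFinset : Set ℝ) ⊆
          Function.support (fun x : ℝ => (1 - x) ^ a * x ^ b * (q * q).eval x)
            ∩ Set.Ioc 0 1 := by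
        intro x hx
        refine ⟨?_, hx.1.1, hx.1.2.le⟩
        have hr : q.eval x ≠ 0 := by
          intro h0
          apply hx.2
          simp [hq, h0]
        have h1 : (0:ℝ) < (1 - x) ^ a := Real.rpow_pos_of_pos (by linarith [hx.1.2]) _
        have h2 : (0:ℝ) < x ^ b := Real.rpow_pos_of_pos hx.1.1 _
        simp only [Function.mem_support, Polynomial.eval_mul]
        have h3 : 0 < q.eval x * q.eval x := mul_self_pos.mpr hr
        positivity
      refine lt_of_lt_of_le ?_ (measure_mono hsub)
      rw [measure_sdiff_null (Set.Finite.measure_zero (Finset.finite_toSet _) _)]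
      simp
    · rw [Set.uIoc_of_le zero_le_one]
      filter_upwards [ae_restrict_mem measurableSet_Ioc] with x hx
      have h1 : (0:ℝ) ≤ (1 - x) ^ a := Real.rpow_nonneg (by linarith [hx.2]) _
      have h2 : (0:ℝ) ≤ x ^ b := Real.rpow_nonneg hx.1.le _
      have h3 : 0 ≤ q.eval x * q.eval x := mul_self_nonneg _
      simp only [Pi.zero_apply, Polynomial.eval_mul]
      positivity
  exact hpos.ne' h

/-- A functional vanishing on the Bernstein-type basis vanishes on all lower degrees. -/
lemma span_vanish (F : ℝ[X] →ₗ[ℝ] ℝ) (N : ℕ)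
    (h : ∀ j k, j + k = N → F (X ^ j * (1 - X) ^ k) = 0) (q : ℝ[X]) (hq : q.natDegree ≤ N) :
    F q = 0 := by
  have key : ∀ m, ∀ j k, j + k + m = N → F (X ^ j * (1 - X) ^ k) = 0 := by
    intro m
    induction m with
    | zero => intro j k e; exact h j k (by omega)
    | succ m ih =>
      intro j k e
      have e1 : (X : ℝ[X]) ^ j * (1 - X) ^ k
          = X ^ (j + 1) * (1 - X) ^ k + X ^ j * (1 - X) ^ (k + 1) := by ring
      rw [e1, map_add, ih (j + 1) k (by omega), ih j (k + 1) (by omega), add_zero]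
  rw [q.as_sum_range_C_mul_X_pow, map_sum]
  apply Finset.sum_eq_zero
  intro l hl
  have hl' : l ≤ N := (Nat.lt_succ_iff.mp (Finset.mem_range.mp hl)).trans hq
  rw [← Polynomial.smul_eq_C_mul, map_smul]
  have := key (N - l) l 0 (by omega)
  rw [pow_zero, mul_one] at this
  rw [this, smul_zero]

/-- Shifted Jacobi polynomial as a polynomial. -/
noncomputable def jacP (a b : ℝ) (n : ℕ) : ℝ[X] :=
  (poch (a + 1) n / (Nat.factorial n)) •
    ∑ l ∈ Finset.range (n + 1),
      (poch (-(n : ℝ)) l * poch ((n : ℝ) + a + b + 1) l /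
        (poch (a + 1) l * (Nat.factorial l))) • (1 - X) ^ l

lemma jacP_eval (a b : ℝ) (n : ℕ) (x : ℝ) : (jacP a b n).eval x = jacobiR a b n x := by
  simp [jacP, jacobiR, Polynomial.eval_finsetSum]

lemma one_sub_X_natDegree : (1 - X : ℝ[X]).natDegree ≤ 1 := by
  refine (Polynomial.natDegree_sub_le _ _).trans ?_
  simp

lemma one_sub_X_pow_natDegree (l : ℕ) : ((1 - X : ℝ[X]) ^ l).natDegree ≤ l :=
  (Polynomial.natDegree_pow_le_of_le l one_sub_X_natDegree).trans (by simp)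

lemma jacP_natDegree (a b : ℝ) (n : ℕ) : (jacP a b n).natDegree ≤ n := by
  unfold jacP
  refine (Polynomial.natDegree_smul_le _ _).trans ?_
  apply Polynomial.natDegree_sum_le_of_forall_le
  intro l hl
  have hl' : l ≤ n := Nat.lt_succ_iff.mp (Finset.mem_range.mp hl)
  exact ((Polynomial.natDegree_smul_le _ _).trans (one_sub_X_pow_natDegree l)).trans hl'

lemma jac_one (a b : ℝ) (n : ℕ) : jacobiR a b n 1 = poch (a + 1) n / n.factorial := by
  unfold jacobiR
  rw [Finset.sum_range_succ']
  simp [poch_zero']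

lemma poch_reflect (b : ℝ) (n : ℕ) : poch (-(n : ℝ) - b) n = (-1) ^ n * poch (b + 1) n := by
  unfold poch
  rw [← Finset.prod_range_reflect (fun j : ℕ => b + 1 + (j : ℝ)) n]
  have : ((-1 : ℝ)) ^ n = ∏ _j ∈ Finset.range n, (-1 : ℝ) := by simp
  rw [this, ← Finset.prod_mul_distrib]
  apply Finset.prod_congr rfl
  intro j hj
  have hj' := Finset.mem_range.mp hj
  rw [Nat.sub_sub, Nat.cast_sub (by omega)]
  push_cast; ring

lemma jac_zero (a b : ℝ) (ha : -1 < a) (n : ℕ) :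
    jacobiR a b n 0 = (-1) ^ n * poch (b + 1) n / n.factorial := by
  unfold jacobiR
  have h := chu n ((n : ℝ) + a + b + 1) (a + 1) (by linarith)
  have e : ∀ l ∈ Finset.range (n + 1), poch (-(n : ℝ)) l * poch ((n : ℝ) + a + b + 1) l /
        (poch (a + 1) l * (Nat.factorial l)) * (1 - 0) ^ l
      = (-1 : ℝ) ^ l * (n.choose l) * (poch ((n : ℝ) + a + b + 1) l / poch (a + 1) l) := by
    intro l _
    rw [poch_neg_nat]
    have : (l.factorial : ℝ) ≠ 0 := by positivity
    have := (poch_pos' (a + 1) (by linarith) l).ne'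
    field_simp
    simp
  rw [Finset.sum_congr rfl e, h, show a + 1 - ((n : ℝ) + a + b + 1) = -(n : ℝ) - b by ring,
    poch_reflect]
  have := (poch_pos' (a + 1) (by linarith) n).ne'
  field_simp

lemma jac_orth (a b : ℝ) (ha : -1 < a) (hb : -1 < b) (n : ℕ) (q : ℝ[X]) (hq : q.natDegree < n) :
    LL a b ha hb (jacP a b n * q) = 0 := by
  let F : ℝ[X] →ₗ[ℝ] ℝ := (LL a b ha hb).comp (LinearMap.mulLeft ℝ (jacP a b n))
  change F q = 0
  apply span_vanish F (n - 1) _ q (by omega)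
  intro j k hjk
  change LL a b ha hb (jacP a b n * (X ^ j * (1 - X) ^ k)) = 0
  unfold jacP
  rw [smul_mul_assoc, map_smul, Finset.sum_mul, map_sum]
  refine smul_eq_zero_of_right _ ?_
  have hn1 : (1 : ℝ) ≤ n := by
    have : 1 ≤ n := by omega
    exact_mod_cast this
  have hjk' : (j : ℝ) + k = n - 1 := by
    have : j + k + 1 = n := by omega
    have : (j : ℝ) + k + 1 = n := by exact_mod_cast this
    linarith
  have hc : 0 < (n : ℝ) + a + b + 1 := by linarith
  have hG := Real.Gamma_pos_of_pos hc
  have hfd := findiff n (pochP (C (a + 1) + X) k)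
    (lt_of_le_of_lt (pochP_deg _ ((Polynomial.natDegree_add_le _ _).trans (by simp)) k) (by omega))
  simp only [pochP_eval, Polynomial.eval_add, Polynomial.eval_C, Polynomial.eval_X] at hfd
  rw [← mul_zero (Real.Gamma (a + 1) * Real.Gamma (b + j + 1) / Real.Gamma ((n : ℝ) + a + b + 1)),
    ← hfd, Finset.mul_sum]
  apply Finset.sum_congr rfl
  intro l _
  rw [smul_mul_assoc, map_smul]
  have e1 : (1 - X : ℝ[X]) ^ l * (X ^ j * (1 - X) ^ k) = X ^ j * (1 - X) ^ (l + k) := by ring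
  rw [e1, LL_mono, poch_neg_nat]
  have g1 : Real.Gamma (a + ((l + k : ℕ) : ℝ) + 1)
      = poch (a + 1 + l) k * (poch (a + 1) l * Real.Gamma (a + 1)) := by
    rw [← Gamma_add_nat' (a + 1) (by linarith), ← Gamma_add_nat' (a + 1 + l) (by
      have : (0:ℝ) ≤ l := by positivity
      linarith)]
    congr 1; push_cast; ring
  have g2 : Real.Gamma (a + b + j + ((l + k : ℕ) : ℝ) + 2)
      = poch ((n : ℝ) + a + b + 1) l * Real.Gamma ((n : ℝ) + a + b + 1) := by
    rw [← Gamma_add_nat' _ hc]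
    congr 1; push_cast; linarith
  rw [g1, g2]
  have p1 := (poch_pos' (a + 1) (by linarith) l).ne'
  have p2 := (poch_pos' _ hc l).ne'
  have p3 : (l.factorial : ℝ) ≠ 0 := by positivity
  have p4 := hG.ne'
  simp only [smul_eq_mul]
  field_simp

/-- Bernstein-form polynomial orthogonal to lower degrees. -/
noncomputable def SS (a b : ℝ) (n : ℕ) : ℝ[X] :=
  ∑ i ∈ Finset.range (n + 1),
    ((-1 : ℝ) ^ i * (n.choose i) / (poch (a + 1) (n - i) * poch (b + 1) i)) •
      (X ^ i * (1 - X) ^ (n - i))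

lemma SS_orth (a b : ℝ) (ha : -1 < a) (hb : -1 < b) (n : ℕ) (q : ℝ[X]) (hq : q.natDegree < n) :
    LL a b ha hb (SS a b n * q) = 0 := by
  let F : ℝ[X] →ₗ[ℝ] ℝ := (LL a b ha hb).comp (LinearMap.mulLeft ℝ (SS a b n))
  change F q = 0
  apply span_vanish F (n - 1) _ q (by omega)
  intro j k hjk
  change LL a b ha hb (SS a b n * (X ^ j * (1 - X) ^ k)) = 0
  unfold SS
  rw [Finset.sum_mul, map_sum]
  have hjk' : (j : ℝ) + k = n - 1 := by
    have : j + k + 1 = n := by omega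
    have : (j : ℝ) + k + 1 = n := by exact_mod_cast this
    linarith
  have hfd := findiff n (pochP (C (a + 1 + n) - X) k * pochP (C (b + 1) + X) j) (by
    refine lt_of_le_of_lt (Polynomial.natDegree_mul_le.trans (add_le_add
      (pochP_deg _ ((Polynomial.natDegree_sub_le _ _).trans
        (max_le (by rw [Polynomial.natDegree_C]; omega) (by simp))) k)
      (pochP_deg _ ((Polynomial.natDegree_add_le _ _).trans (by simp)) j))) (by omega))
  simp only [pochP_eval, Polynomial.eval_add, Polynomial.eval_C, Polynomial.eval_X,
    Polynomial.eval_mul, Polynomial.eval_sub] at hfd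
  rw [← mul_zero (Real.Gamma (a + 1) * Real.Gamma (b + 1) / Real.Gamma (a + b + 2 * n + 1)),
    ← hfd, Finset.mul_sum]
  apply Finset.sum_congr rfl
  intro i hi
  have hi' : i ≤ n := Nat.lt_succ_iff.mp (Finset.mem_range.mp hi)
  have hi'' : (i : ℝ) ≤ n := by exact_mod_cast hi'
  have hi0 : (0 : ℝ) ≤ i := by positivity
  rw [smul_mul_assoc, map_smul]
  have e1 : (X : ℝ[X]) ^ i * (1 - X) ^ (n - i) * (X ^ j * (1 - X) ^ k)
      = X ^ (i + j) * (1 - X) ^ (n - i + k) := by ring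
  rw [e1, LL_mono]
  have g1 : Real.Gamma (a + ((n - i + k : ℕ) : ℝ) + 1)
      = poch (a + 1 + n - i) k * (poch (a + 1) (n - i) * Real.Gamma (a + 1)) := by
    rw [← Gamma_add_nat' (a + 1) (by linarith), Nat.cast_sub hi',
      show a + 1 + ((n : ℝ) - i) = a + 1 + n - i by ring, ← Gamma_add_nat' _ (by linarith)]
    congr 1; push_cast [Nat.cast_sub hi']; ring
  have g2 : Real.Gamma (b + ((i + j : ℕ) : ℝ) + 1)
      = poch (b + 1 + i) j * (poch (b + 1) i * Real.Gamma (b + 1)) := by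
    rw [← Gamma_add_nat' (b + 1) (by linarith), ← Gamma_add_nat' _ (by linarith)]
    congr 1; push_cast; ring
  have g3 : a + b + ((i + j : ℕ) : ℝ) + ((n - i + k : ℕ) : ℝ) + 2 = a + b + 2 * n + 1 := by
    push_cast [Nat.cast_sub hi']; linarith
  rw [g1, g2, g3]
  have p1 := (poch_pos' (a + 1) (by linarith) (n - i)).ne'
  have p2 := (poch_pos' (b + 1) (by linarith) i).ne'
  simp only [smul_eq_mul]
  field_simp

lemma SS_total (a b : ℝ) (ha : -1 < a) (hb : -1 < b) (n : ℕ) :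
    LL a b ha hb (SS a (b + 1) n)
      = Real.Gamma (a + 1) * Real.Gamma (b + 1) / Real.Gamma (a + b + n + 2)
        * (n.factorial * (b + 1) / poch (b + 1) (n + 1)) := by
  unfold SS
  rw [map_sum]
  have h := chu n (b + 1) (b + 1 + 1) (by linarith)
  rw [show b + 1 + 1 - (b + 1) = 1 by ring, poch_one'] at h
  rw [poch_succ_left (b + 1), mul_comm (n.factorial : ℝ) (b + 1),
    mul_div_mul_left _ _ (by linarith : b + 1 ≠ 0), ← h, Finset.mul_sum]
  apply Finset.sum_congr rfl
  intro i hi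
  have hi' : i ≤ n := Nat.lt_succ_iff.mp (Finset.mem_range.mp hi)
  rw [map_smul, LL_mono]
  have g1 : Real.Gamma (a + ((n - i : ℕ) : ℝ) + 1)
      = poch (a + 1) (n - i) * Real.Gamma (a + 1) := by
    rw [← Gamma_add_nat' (a + 1) (by linarith)]
    congr 1; ring
  have g2 : Real.Gamma (b + (i : ℝ) + 1) = poch (b + 1) i * Real.Gamma (b + 1) := by
    rw [← Gamma_add_nat' (b + 1) (by linarith)]
    congr 1; ring
  have g3 : a + b + (i : ℝ) + ((n - i : ℕ) : ℝ) + 2 = a + b + n + 2 := by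
    push_cast [Nat.cast_sub hi']; ring
  rw [g1, g2, g3]
  have p1 := (poch_pos' (a + 1) (by linarith) (n - i)).ne'
  have p2 := (poch_pos' (b + 1 + 1) (by linarith) i).ne'
  simp only [smul_eq_mul]
  field_simp

lemma dual_LL (n : ℕ) (α β : ℝ) (hα : -1 < α) (hβ : -1 < β) (D : ℕ → ℝ[X])
    (hD : IsDualBernstein n α β D) (i j : ℕ) (hi : i ≤ n) (hj : j ≤ n) :
    (n.choose i : ℝ) * LL α β hα hβ (X ^ i * (1 - X) ^ (n - i) * D j) = if i = j then 1 else 0 := by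
  rw [← hD.2 i hi j hj, ← smul_eq_mul, ← map_smul, LL_apply]
  congr 1; ext x
  simp [bern]
  ring

lemma dual_zero (n : ℕ) (α β : ℝ) (hα : -1 < α) (hβ : -1 < β) (D : ℕ → ℝ[X])
    (hD : IsDualBernstein n α β D) (j : ℕ) (hj : j ≤ n) :
    (D j).eval 0 * (Real.Gamma (α + 1) * Real.Gamma (β + 1) / Real.Gamma (α + β + n + 2)
        * (n.factorial * (β + 1) / poch (β + 1) (n + 1)))
      = (-1) ^ j / (poch (α + 1) (n - j) * poch (β + 2) j) := by
  rw [← SS_total α β hα hβ n]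
  have hdec : D j = C ((D j).eval 0) + X * (D j).divX := by
    conv_lhs => rw [← Polynomial.X_mul_divX_add (D j)]
    rw [Polynomial.coeff_zero_eq_eval_zero, add_comm]
  have h1 : LL α β hα hβ (SS α (β + 1) n * D j)
      = (D j).eval 0 * LL α β hα hβ (SS α (β + 1) n) := by
    have horth : LL α β hα hβ (X ^ 1 * (1 - X) ^ 0 * (SS α (β + 1) n * (D j).divX)) = 0 := by
      rw [LL_shift α β hα hβ 1 0 _ (by simpa using hα) (by push_cast; linarith)]
      simp only [Nat.cast_zero, Nat.cast_one, add_zero]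
      rcases Nat.eq_zero_or_pos n with h0 | h0
      · have : (D j).divX = 0 := by
          rw [Polynomial.divX_eq_zero_iff]
          have := hD.1 j hj
          rw [h0] at this
          exact Polynomial.eq_C_of_natDegree_le_zero this
        rw [this, mul_zero, map_zero]
      · apply SS_orth
        rw [Polynomial.natDegree_divX_eq_natDegree_tsub_one]
        have := hD.1 j hj
        omega
    have e : SS α (β + 1) n * D j = (D j).eval 0 • SS α (β + 1) n
        + X ^ 1 * (1 - X) ^ 0 * (SS α (β + 1) n * (D j).divX) := by
      rw [Polynomial.smul_eq_C_mul]
      conv_lhs => rw [hdec]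
      ring
    rw [e, map_add, horth, add_zero, map_smul, smul_eq_mul]
  rw [← h1]
  unfold SS
  rw [Finset.sum_mul, map_sum, Finset.sum_eq_single j]
  · have := dual_LL n α β hα hβ D hD j j hj hj
    rw [if_pos rfl] at this
    rw [smul_mul_assoc, map_smul, smul_eq_mul, show β + 1 + 1 = β + 2 by ring]
    rw [div_mul_eq_mul_div, mul_assoc, this, mul_one]
  · intro i hi hij
    have hi' : i ≤ n := Nat.lt_succ_iff.mp (Finset.mem_range.mp hi)
    have := dual_LL n α β hα hβ D hD i j hi' hj
    rw [if_neg hij] at this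
    rw [smul_mul_assoc, map_smul, smul_eq_mul, div_mul_eq_mul_div, mul_assoc, this]
    simp
  · intro h
    exact absurd (Finset.mem_range.mpr (Nat.lt_succ_of_le hj)) h

lemma dual_reflect (n : ℕ) (α β : ℝ) (D : ℕ → ℝ[X])
    (hD : IsDualBernstein n α β D) :
    IsDualBernstein n β α (fun j => (D (n - j)).comp (1 - X)) := by
  refine ⟨?_, ?_⟩
  · intro j hj
    refine (Polynomial.natDegree_comp_le).trans ?_
    have := hD.1 (n - j) (by omega)
    have h2 := one_sub_X_natDegree
    nlinarith
  · intro i hi j hj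
    have h := hD.2 (n - i) (by omega) (n - j) (by omega)
    have h3 := intervalIntegral.integral_comp_sub_left (a := 0) (b := 1)
      (fun x : ℝ => (1 - x) ^ α * x ^ β * bern n (n - i) x * (D (n - j)).eval x) 1
    simp only [sub_self, sub_zero] at h3
    rw [h] at h3
    have hc : (n - i = n - j) ↔ (i = j) := by omega
    simp only [hc] at h3
    rw [← h3]
    congr 1; ext x
    simp only [bern, Nat.choose_symm hi, Nat.sub_sub_self hi, sub_sub_cancel,
      Polynomial.eval_comp, Polynomial.eval_sub, Polynomial.eval_one, Polynomial.eval_X]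
    ring

lemma dual_one (n : ℕ) (α β : ℝ) (hα : -1 < α) (hβ : -1 < β) (D : ℕ → ℝ[X])
    (hD : IsDualBernstein n α β D) (j : ℕ) (hj : j ≤ n) :
    (D j).eval 1 * (Real.Gamma (α + 1) * Real.Gamma (β + 1) / Real.Gamma (α + β + n + 2)
        * (n.factorial * (α + 1) / poch (α + 1) (n + 1)))
      = (-1) ^ (n - j) / (poch (α + 2) (n - j) * poch (β + 1) j) := by
  have h := dual_zero n β α hβ hα _ (dual_reflect n α β D hD) (n - j) (by omega)
  simp only [Nat.sub_sub_self hj, Polynomial.eval_comp, Polynomial.eval_sub, Polynomial.eval_one,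
    Polynomial.eval_X, sub_zero] at h
  rw [mul_comm (poch (α + 2) _), ← h, add_comm β α, mul_comm (Real.Gamma (β + 1))]

/-- Uniqueness. -/
lemma uniq (n : ℕ) (α β : ℝ) (hα : -1 < α) (hβ : -1 < β) (P : ℝ[X]) (hdeg : P.natDegree ≤ n + 1)
    (horth : ∀ q : ℝ[X], q.natDegree < n → LL α β hα hβ (P * q) = 0)
    (h0 : P.eval 0 = 0) (h1 : P.eval 1 = 0) : P = 0 := by
  have d0 : X ∣ P := by
    rw [Polynomial.X_dvd_iff, Polynomial.coeff_zero_eq_eval_zero, h0]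
  obtain ⟨Q, rfl⟩ := d0
  have hQ1 : Q.eval 1 = 0 := by simpa using h1
  obtain ⟨R, rfl⟩ := Polynomial.dvd_iff_isRoot.mpr (show Q.IsRoot 1 from hQ1)
  by_cases hR : R = 0
  · simp [hR]
  have hd : (X * ((X - C 1) * R)).natDegree = R.natDegree + 2 := by
    rw [Polynomial.natDegree_mul Polynomial.X_ne_zero
      (mul_ne_zero (Polynomial.X_sub_C_ne_zero _) hR),
      Polynomial.natDegree_mul (Polynomial.X_sub_C_ne_zero _) hR, Polynomial.natDegree_X,
      Polynomial.natDegree_X_sub_C]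
    ring
  rw [hd] at hdeg
  have := horth R (by omega)
  have e : X * ((X - C 1) * R) * R = (-1 : ℝ) • (X ^ 1 * (1 - X) ^ 1 * (R * R)) := by
    rw [Polynomial.smul_eq_C_mul]
    simp only [map_one, map_neg]
    ring
  rw [e, map_smul, LL_shift α β hα hβ 1 1 _ (by push_cast; linarith) (by push_cast; linarith)]
    at this
  have h3 : LL (α + (1:ℕ)) (β + (1:ℕ)) (by push_cast; linarith) (by push_cast; linarith) (R * R)
      = 0 := by
    simpa using this
  exact absurd (LL_sq_zero _ _ _ _ R h3) hR

lemma zero_rec (n : ℕ) (α β : ℝ) (hα : -1 < α) (hβ : -1 < β) (D : ℕ → ℝ[X])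
    (hD : IsDualBernstein n α β D) (i : ℕ) (hi : i ≤ n) :
    ((n:ℝ)-i+1)*((i:ℝ)+β+1) * (D i).eval 0 - (i:ℝ)*((n:ℝ)-i+α+1) * (D (i-1)).eval 0
      = ((-1)^(n-i) * ((n:ℝ)+1) * poch (α+β+2) n /
      ((Real.Gamma (α+1) * Real.Gamma (β+1) / Real.Gamma (α+β+2)) * poch (α+1) (n-i)
        * poch (β+1) i)) * (((n:ℝ)+β+1) * jacobiR (α+1) β n 0) := by
  have hi'' : (i : ℝ) ≤ n := by exact_mod_cast hi
  have hi0 : (0 : ℝ) ≤ i := by positivity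
  have hstep : (i:ℝ)*((n:ℝ)-i+α+1) * (D (i-1)).eval 0 = -((i:ℝ) * ((i:ℝ)+β+1) * (D i).eval 0) := by
    rcases Nat.eq_zero_or_pos i with h0 | h0
    · simp [h0]
    · have h1 := dual_zero n α β hα hβ D hD i hi
      have h2 := dual_zero n α β hα hβ D hD (i-1) (by omega)
      set L0 := Real.Gamma (α + 1) * Real.Gamma (β + 1) / Real.Gamma (α + β + n + 2)
        * (n.factorial * (β + 1) / poch (β + 1) (n + 1)) with hL0
      have hL : L0 ≠ 0 := by
        have g1 := Real.Gamma_pos_of_pos (by linarith : 0 < α + 1)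
        have g2 := Real.Gamma_pos_of_pos (by linarith : 0 < β + 1)
        have g3 := Real.Gamma_pos_of_pos (by linarith : 0 < α + β + n + 2)
        have g4 := poch_pos' (β + 1) (by linarith) (n + 1)
        have g5 : 0 < β + 1 := by linarith
        have : 0 < L0 := by rw [hL0]; positivity
        exact this.ne'
      obtain ⟨m, rfl⟩ : ∃ m, i = m + 1 := ⟨i - 1, by omega⟩
      obtain ⟨r, rfl⟩ : ∃ r, n = r + (m + 1) := ⟨n - (m + 1), by omega⟩
      rw [show r + (m + 1) - (m + 1) = r by omega] at h1
      rw [show r + (m + 1) - (m + 1 - 1) = r + 1 by omega, Nat.add_sub_cancel] at h2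
      rw [Nat.add_sub_cancel]
      rw [poch_succ' (β + 2)] at h1
      rw [poch_succ' (α + 1)] at h2
      have p1 := (poch_pos' (α + 1) (by linarith) r).ne'
      have p2 := (poch_pos' (β + 2) (by linarith) m).ne'
      have p3 : α + 1 + r ≠ 0 := by
        have : (0:ℝ) ≤ r := by positivity
        linarith
      have p4 : β + 2 + m ≠ 0 := by
        have : (0:ℝ) ≤ m := by positivity
        linarith
      apply mul_right_cancel₀ hL
      rw [mul_assoc, h2, neg_mul, mul_assoc _ _ L0, h1]
      push_cast
      rw [pow_succ]
      field_simp
      ring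
  have h1 := dual_zero n α β hα hβ D hD i hi
  rw [hstep, jac_zero _ _ (by linarith)]
  have e1 : poch (β + 2) i = poch (β + 1) i * (β + 1 + i) / (β + 1) := by
    rw [← poch_succ', poch_succ_left, show β + 1 + 1 = β + 2 by ring,
      mul_div_cancel_left₀ _ (by linarith : β + 1 ≠ 0)]
  have e2 : Real.Gamma (α + β + n + 2) = poch (α + β + 2) n * Real.Gamma (α + β + 2) := by
    rw [← Gamma_add_nat' _ (by linarith)]
    congr 1; ring
  rw [e1, e2, poch_succ'] at h1
  have g1 := (Real.Gamma_pos_of_pos (by linarith : 0 < α + 1)).ne'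
  have g2 := (Real.Gamma_pos_of_pos (by linarith : 0 < β + 1)).ne'
  have g3 := (Real.Gamma_pos_of_pos (by linarith : 0 < α + β + 2)).ne'
  have p1 := (poch_pos' (α + 1) (by linarith) (n - i)).ne'
  have p2 := (poch_pos' (β + 1) (by linarith) i).ne'
  have p3 := (poch_pos' (β + 1) (by linarith) n).ne'
  have p4 := (poch_pos' (α + β + 2) (by linarith) n).ne'
  have p5 : β + 1 ≠ 0 := by linarith
  have p6 : β + 1 + i ≠ 0 := by linarith
  have p7 : β + 1 + n ≠ 0 := by linarith
  have p8 : (n.factorial : ℝ) ≠ 0 := by positivity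
  have hs : (-1 : ℝ) ^ (n - i) * (-1) ^ n = (-1) ^ i := by
    obtain ⟨m, rfl⟩ := Nat.exists_eq_add_of_le hi
    rw [Nat.add_sub_cancel_left, pow_add, mul_left_comm, ← mul_pow]; simp
  have key : (D i).eval 0 = (-1) ^ i * (β + 1) / (poch (α + 1) (n - i) * (poch (β + 1) i
      * (β + 1 + i))) * (poch (α + β + 2) n * Real.Gamma (α + β + 2)
        * (poch (β + 1) n * (β + 1 + n)) /
      (Real.Gamma (α + 1) * Real.Gamma (β + 1) * (n.factorial * (β + 1)))) := by
    field_simp at h1 ⊢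
    linear_combination h1
  rw [key, ← hs]
  field_simp
  ring

lemma one_rec (n : ℕ) (α β : ℝ) (hα : -1 < α) (hβ : -1 < β) (D : ℕ → ℝ[X])
    (hD : IsDualBernstein n α β D) (i : ℕ) (hi : i ≤ n) :
    ((i:ℝ)+1)*((n:ℝ)-i+α+1) * (D i).eval 1 - ((n:ℝ)-i)*((i:ℝ)+β+1) * (D (i+1)).eval 1
      = ((-1)^(n-i) * ((n:ℝ)+1) * poch (α+β+2) n /
      ((Real.Gamma (α+1) * Real.Gamma (β+1) / Real.Gamma (α+β+2)) * poch (α+1) (n-i)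
        * poch (β+1) i)) * (((n:ℝ)+α+1) * jacobiR α (β+1) n 1) := by
  have h := zero_rec n β α hβ hα _ (dual_reflect n α β D hD) (n - i) (by omega)
  simp only [Nat.sub_sub_self hi, Polynomial.eval_comp, Polynomial.eval_sub, Polynomial.eval_one,
    Polynomial.eval_X, sub_zero, Nat.cast_sub hi] at h
  rw [jac_zero _ _ (by linarith)] at h
  rw [jac_one]
  have hs : (-1 : ℝ) ^ (n - i) = (-1) ^ n * (-1) ^ i := by
    obtain ⟨m, rfl⟩ := Nat.exists_eq_add_of_le hi
    rw [Nat.add_sub_cancel_left, pow_add, mul_right_comm, ← mul_pow]; simp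
  have hE : ((n:ℝ)-i)*((i:ℝ)+β+1) * (D (i+1)).eval 1
      = ((n:ℝ)-i)*((n:ℝ)-(n-i)+β+1) * (D (n - (n - i - 1))).eval 1 := by
    rcases Nat.eq_or_lt_of_le hi with h0 | h0
    · simp [h0]
    · rw [show n - (n - i - 1) = i + 1 by omega]; ring
  rw [hE, hs]
  rw [show β + α + 2 = α + β + 2 by ring, mul_comm (Real.Gamma (β + 1))] at h
  linear_combination h

lemma orth1 (n : ℕ) (α β : ℝ) (hα : -1 < α) (hβ : -1 < β) (D : ℕ → ℝ[X])
    (hD : IsDualBernstein n α β D) (i : ℕ) (hi : i ≤ n) (j k : ℕ) (hjk : j + k + 1 = n) :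
    (i:ℝ) * LL α β hα hβ (X ^ j * (1 - X) ^ (k + 1) * D (i - 1))
      = ((n:ℝ) - i + 1) * LL α β hα hβ (X ^ (j + 1) * (1 - X) ^ k * D i) := by
  have h1 := dual_LL n α β hα hβ D hD j (i - 1) (by omega) (by omega)
  have h2 := dual_LL n α β hα hβ D hD (j + 1) i (by omega) (by omega)
  rw [show n - j = k + 1 by omega] at h1
  rw [show n - (j + 1) = k by omega] at h2
  have c1 : (n.choose j : ℝ) ≠ 0 := by
    exact_mod_cast (Nat.choose_pos (by omega : j ≤ n)).ne'
  have c2 : (n.choose (j + 1) : ℝ) ≠ 0 := by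
    exact_mod_cast (Nat.choose_pos (by omega : j + 1 ≤ n)).ne'
  by_cases hij : j + 1 = i
  · subst hij
    rw [if_pos (by omega)] at h1
    rw [Nat.add_sub_cancel] at h1 ⊢
    rw [if_pos rfl] at h2
    have h3 : ((n.choose (j + 1) : ℕ) : ℝ) * (j + 1) = n.choose j * ((n : ℝ) - j) := by
      have := Nat.choose_succ_right_eq n j
      rw [← Nat.cast_sub (by omega)]
      exact_mod_cast this
    apply mul_left_cancel₀ c1
    apply mul_left_cancel₀ c2
    push_cast
    linear_combination ((n.choose (j+1) : ℝ) * (j + 1)) * h1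
      - ((n.choose j : ℝ) * (n - j)) * h2 + h3
  · rw [if_neg hij] at h2
    have h2' := (mul_eq_zero.mp h2).resolve_left c2
    rw [h2', mul_zero]
    rcases Nat.eq_zero_or_pos i with h0 | h0
    · simp [h0]
    · rw [if_neg (by omega)] at h1
      rw [(mul_eq_zero.mp h1).resolve_left c1, mul_zero]

lemma orth2 (n : ℕ) (α β : ℝ) (hα : -1 < α) (hβ : -1 < β) (D : ℕ → ℝ[X])
    (hD : IsDualBernstein n α β D) (i : ℕ) (hi : i ≤ n) (j k : ℕ) (hjk : j + k + 1 = n) :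
    ((n:ℝ) - i) * LL α β hα hβ (X ^ (j + 1) * (1 - X) ^ k * D (i + 1))
      = ((i:ℝ) + 1) * LL α β hα hβ (X ^ j * (1 - X) ^ (k + 1) * D i) := by
  rcases Nat.eq_or_lt_of_le hi with h0 | h0
  · have h1 := dual_LL n α β hα hβ D hD j i (by omega) (by omega)
    rw [show n - j = k + 1 by omega, if_neg (by omega)] at h1
    have c1 : (n.choose j : ℝ) ≠ 0 := by
      exact_mod_cast (Nat.choose_pos (by omega : j ≤ n)).ne'
    rw [(mul_eq_zero.mp h1).resolve_left c1, h0]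
    ring
  · have := orth1 n α β hα hβ D hD (i + 1) h0 j k hjk
    rw [Nat.add_sub_cancel] at this
    push_cast at this
    linear_combination -this

/-- Second-order non-homogeneous recurrence relation for dual Bernstein
polynomials (Theorem 5.1 of the paper). -/
theorem dualBernstein_nonhomogeneous_recurrence (n : ℕ) (α β : ℝ)
    (hα : α > -1) (hβ : β > -1)
    (D : ℕ → Polynomial ℝ) (hD : IsDualBernstein n α β D)
    (i : ℕ) (hi : i ≤ n) (x : ℝ) :
    (i:ℝ)*((i:ℝ)+1)*((n:ℝ)-i+α+1)*(x-1) * (D (i-1)).eval x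
      - ((n:ℝ)-i)*((n:ℝ)-i+1)*((i:ℝ)+β+1)*x * (D (i+1)).eval x
      + ((i:ℝ)+1)*((n:ℝ)-i+1)*(((i:ℝ)+β+1)*(1-x) + ((n:ℝ)-i+α+1)*x) * (D i).eval x
      = ((-1)^(n-i) * ((n:ℝ)+1) * poch (α+β+2) n /
      ((Real.Gamma (α+1) * Real.Gamma (β+1) / Real.Gamma (α+β+2)) * poch (α+1) (n-i) * poch (β+1) i)) *
        (((i:ℝ)+1)*((n:ℝ)+β+1)*(1-x)*jacobiR (α+1) β n x
          + ((n:ℝ)-i+1)*((n:ℝ)+α+1)*x*jacobiR α (β+1) n x) := by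
  have hα' : -1 < α := hα
  have hβ' : -1 < β := hβ
  have hi'' : (i : ℝ) ≤ n := by exact_mod_cast hi
  set A : ℝ := ((-1)^(n-i) * ((n:ℝ)+1) * poch (α+β+2) n /
      ((Real.Gamma (α+1) * Real.Gamma (β+1) / Real.Gamma (α+β+2)) * poch (α+1) (n-i)
        * poch (β+1) i)) with hA
  obtain ⟨E, hE⟩ : ∃ E : ℝ[X], E = if i < n then D (i + 1) else 0 := ⟨_, rfl⟩
  have hEdeg : E.natDegree ≤ n := by
    rw [hE]; split_ifs with h
    · exact hD.1 _ h
    · simp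
  have hEsm : ((n:ℝ) - i) • E = ((n:ℝ) - i) • D (i + 1) := by
    rw [hE]; split_ifs with h
    · rfl
    · have : (i : ℝ) = n := by
        have : i = n := by omega
        exact_mod_cast this
      simp [this]
  have hEval : ∀ y : ℝ, ((n:ℝ) - i) * E.eval y = ((n:ℝ) - i) * (D (i + 1)).eval y := by
    intro y
    have := congrArg (Polynomial.eval y) hEsm
    simpa using this
  have hELL : ∀ p : ℝ[X], ((n:ℝ) - i) * LL α β hα' hβ' (p * E)
      = ((n:ℝ) - i) * LL α β hα' hβ' (p * D (i + 1)) := by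
    intro p
    rw [← smul_eq_mul, ← map_smul, ← mul_smul_comm, hEsm, mul_smul_comm, map_smul, smul_eq_mul]
  obtain ⟨P, hP⟩ : ∃ P : ℝ[X], P =
      (-((i:ℝ)*((i:ℝ)+1)*((n:ℝ)-i+α+1))) • ((1 - X) * D (i-1))
      - (((n:ℝ)-i)*((n:ℝ)-i+1)*((i:ℝ)+β+1)) • (X * E)
      + (((i:ℝ)+1)*((n:ℝ)-i+1)*((i:ℝ)+β+1)) • ((1 - X) * D i)
      + (((i:ℝ)+1)*((n:ℝ)-i+1)*((n:ℝ)-i+α+1)) • (X * D i)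
      - (A * (((i:ℝ)+1)*((n:ℝ)+β+1))) • ((1 - X) * jacP (α+1) β n)
      - (A * (((n:ℝ)-i+1)*((n:ℝ)+α+1))) • (X * jacP α (β+1) n) := ⟨_, rfl⟩
  have hPeval : ∀ y : ℝ, P.eval y =
      -((i:ℝ)*((i:ℝ)+1)*((n:ℝ)-i+α+1)) * ((1 - y) * (D (i-1)).eval y)
      - ((n:ℝ)-i)*((n:ℝ)-i+1)*((i:ℝ)+β+1) * (y * E.eval y)
      + ((i:ℝ)+1)*((n:ℝ)-i+1)*((i:ℝ)+β+1) * ((1 - y) * (D i).eval y)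
      + ((i:ℝ)+1)*((n:ℝ)-i+1)*((n:ℝ)-i+α+1) * (y * (D i).eval y)
      - A * (((i:ℝ)+1)*((n:ℝ)+β+1)) * ((1 - y) * jacobiR (α+1) β n y)
      - A * (((n:ℝ)-i+1)*((n:ℝ)+α+1)) * (y * jacobiR α (β+1) n y) := by
    intro y
    rw [hP]
    simp only [Polynomial.eval_add, Polynomial.eval_sub, Polynomial.eval_smul, smul_eq_mul,
      Polynomial.eval_mul, Polynomial.eval_X, Polynomial.eval_one, jacP_eval]
  have hPz : P = 0 := by
    apply uniq n α β hα' hβ' P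
    · have d1 : ∀ (c : ℝ) (p : ℝ[X]), p.natDegree ≤ n →
          (c • ((1 - X) * p)).natDegree ≤ n + 1 := by
        intro c p hp
        refine (Polynomial.natDegree_smul_le _ _).trans (Polynomial.natDegree_mul_le.trans ?_)
        have := one_sub_X_natDegree
        omega
      have d2 : ∀ (c : ℝ) (p : ℝ[X]), p.natDegree ≤ n →
          (c • (X * p)).natDegree ≤ n + 1 := by
        intro c p hp
        refine (Polynomial.natDegree_smul_le _ _).trans (Polynomial.natDegree_mul_le.trans ?_)
        rw [Polynomial.natDegree_X]
        omega
      rw [hP]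
      refine Polynomial.natDegree_sub_le_of_le (Polynomial.natDegree_sub_le_of_le
        (Polynomial.natDegree_add_le_of_le (Polynomial.natDegree_add_le_of_le
        (Polynomial.natDegree_sub_le_of_le (m := n + 1) (n := n + 1) (d1 _ _ (hD.1 _ (by omega)))
          (d2 _ _ hEdeg)) (n := n + 1) (d1 _ _ (hD.1 _ hi))) (n := n + 1) (d2 _ _ (hD.1 _ hi)))
        (n := n + 1) (d1 _ _ (jacP_natDegree _ _ _))) (n := n + 1)
        (d2 _ _ (jacP_natDegree _ _ _)) |>.trans ?_
      simp
    · intro q hq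
      let F : ℝ[X] →ₗ[ℝ] ℝ := (LL α β hα' hβ').comp (LinearMap.mulLeft ℝ P)
      change F q = 0
      apply span_vanish F (n - 1) _ q (by omega)
      intro j k hjk
      change LL α β hα' hβ' (P * (X ^ j * (1 - X) ^ k)) = 0
      have hjk' : j + k + 1 = n := by omega
      have hdeg : ((X : ℝ[X]) ^ j * (1 - X) ^ k).natDegree < n := by
        refine lt_of_le_of_lt Polynomial.natDegree_mul_le ?_
        have := one_sub_X_pow_natDegree k
        rw [Polynomial.natDegree_X_pow]
        omega
      have j1 : LL α β hα' hβ' (X ^ 0 * (1 - X) ^ 1 *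
          (jacP (α+1) β n * (X ^ j * (1 - X) ^ k))) = 0 := by
        rw [LL_shift α β hα' hβ' 0 1 _ (by push_cast; linarith) (by simpa using hβ')]
        simp only [Nat.cast_zero, Nat.cast_one, add_zero]
        exact jac_orth _ _ _ _ _ _ hdeg
      have j2 : LL α β hα' hβ' (X ^ 1 * (1 - X) ^ 0 *
          (jacP α (β+1) n * (X ^ j * (1 - X) ^ k))) = 0 := by
        rw [LL_shift α β hα' hβ' 1 0 _ (by simpa using hα') (by push_cast; linarith)]
        simp only [Nat.cast_zero, Nat.cast_one, add_zero]
        exact jac_orth _ _ _ _ _ _ hdeg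
      have o1 := orth1 n α β hα' hβ' D hD i hi j k hjk'
      have o2 := orth2 n α β hα' hβ' D hD i hi j k hjk'
      rw [← hELL] at o2
      have e : P * (X ^ j * (1 - X) ^ k) =
        (-((i:ℝ)*((i:ℝ)+1)*((n:ℝ)-i+α+1))) • (X ^ j * (1 - X) ^ (k + 1) * D (i-1))
        - (((n:ℝ)-i)*((n:ℝ)-i+1)*((i:ℝ)+β+1)) • (X ^ (j + 1) * (1 - X) ^ k * E)
        + (((i:ℝ)+1)*((n:ℝ)-i+1)*((i:ℝ)+β+1)) • (X ^ j * (1 - X) ^ (k + 1) * D i)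
        + (((i:ℝ)+1)*((n:ℝ)-i+1)*((n:ℝ)-i+α+1)) • (X ^ (j + 1) * (1 - X) ^ k * D i)
        - (A * (((i:ℝ)+1)*((n:ℝ)+β+1))) • (X ^ 0 * (1 - X) ^ 1 *
          (jacP (α+1) β n * (X ^ j * (1 - X) ^ k)))
        - (A * (((n:ℝ)-i+1)*((n:ℝ)+α+1))) • (X ^ 1 * (1 - X) ^ 0 *
          (jacP α (β+1) n * (X ^ j * (1 - X) ^ k))) := by
        rw [hP]
        simp only [Polynomial.smul_eq_C_mul]
        ring
      rw [e]
      simp only [map_add, map_sub, map_smul, smul_eq_mul, j1, j2]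
      linear_combination (-((i:ℝ)+1)*((n:ℝ)-i+α+1)) * o1 - (((n:ℝ)-i+1)*((i:ℝ)+β+1)) * o2
    · have h := zero_rec n α β hα' hβ' D hD i hi
      rw [← hA] at h
      rw [hPeval]
      linear_combination ((i:ℝ)+1) * h
    · have h := one_rec n α β hα' hβ' D hD i hi
      rw [← hA] at h
      rw [hPeval]
      linear_combination ((n:ℝ)-i+1) * h - (((n:ℝ)-i+1)*((i:ℝ)+β+1)) * hEval 1
  have h := hPeval x
  rw [hPz, Polynomial.eval_zero] at h
  linear_combination -h + (((n:ℝ)-i+1)*((i:ℝ)+β+1)*x) * hEval x
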